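/- The alternating group A_6 does not have property (I_3) with respect to any of its subgroups (even though A_6 is a maximal subgroup of PSL_3(4), which does have property (I_3)); in other words, for no subgroup H ≤ A_6 of order coprime to 3 is the permutation module k[A_6/H] indecomposable, where k is an algebraically closed field of characteristic 3. -/

import Mathlib

/-- A module is indecomposable if it is nonzero and admits no nontrivial direct sum
decomposition. -/
def IsIndecomposableModule (R M : Type*) [Ring R] [AddCommMonoid M] [Module R M] : Prop :=
  Nontrivial M ∧ ∀ N N' : Submodule R M, IsCompl N N' → N = ⊥ ∨ N' = ⊥

/-- The permutation module `k[G/H]`, as a module over the group algebra `k[G]`. -/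
abbrev PermMod (k : Type*) [Field k] {G : Type*} [Group G] (H : Subgroup G) :=
  (Representation.ofMulAction k G (G ⧸ H)).asModule

/-- A finite group `G` has property `(I_p)` with respect to a subgroup `H` if `H` is a
`p'`-subgroup and the permutation module `k[G/H]` is indecomposable (equivalently, it is the
projective cover of the trivial `k[G]`-module). -/
def HasIp (k : Type*) [Field k] {G : Type*} [Group G] (p : ℕ) (H : Subgroup G) : Prop :=
  ¬ (p ∣ Nat.card H) ∧ IsIndecomposableModule (MonoidAlgebra k G) (PermMod k H)

open Equiv

namespace A6St

/-- The Steinberg character of `A_6 = PSL_2(9)` modulo 3, with values lifted to `0, 1, 2`. -/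
def stF (g : Perm (Fin 6)) : ℕ :=
  if g = 1 then 0 else if g ^ 4 = 1 then 1 else if g ^ 5 = 1 then 2 else 0

theorem stF_conj (c g : Perm (Fin 6)) : stF (c * g * c⁻¹) = stF g := by
  simp only [stF, conj_pow, conj_eq_one_iff]

theorem stF_inv (g : Perm (Fin 6)) : stF g⁻¹ = stF g := by
  simp only [stF, inv_pow, inv_eq_one]

/-! ### List encoding of permutations, used for the one finite computation -/

def ap (l : List ℕ) (i : ℕ) : ℕ := l.getD i 0

def isid (l : List ℕ) : Bool := l == [0, 1, 2, 3, 4, 5]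

def cmp (l m : List ℕ) : List ℕ := m.map (ap l)

def sq (l : List ℕ) : List ℕ := cmp l l

def fl (l : List ℕ) : ℕ :=
  bif isid l then 0 else
    bif isid (sq (sq l)) then 1 else bif isid (cmp (sq (sq l)) l) then 2 else 0

def sgl (l : List ℕ) : ℤ :=
  ((List.finRange 6).map fun j : Fin 6 => ((List.finRange 6).map fun i : Fin 6 =>
    if i < j then (if ap l i < ap l j then (1 : ℤ) else -1) else 1).prod).prod

def code (g : Perm (Fin 6)) : List ℕ := List.ofFn fun i => (g i : ℕ)

theorem ap_code (g : Perm (Fin 6)) (i : Fin 6) : ap (code g) i = g i := by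
  fin_cases i <;> rfl

theorem code_mul (g h : Perm (Fin 6)) : code (g * h) = cmp (code g) (code h) := by
  unfold cmp
  conv_rhs => rw [show code h = List.ofFn fun i => (h i : ℕ) from rfl]
  rw [List.map_ofFn]
  unfold code
  congr 1
  funext i
  exact (ap_code g (h i)).symm

theorem code_injective : Function.Injective code := by
  intro g h e
  ext i
  rw [← ap_code, ← ap_code, e]

theorem isid_code (g : Perm (Fin 6)) : isid (code g) = true ↔ g = 1 := by
  unfold isid
  rw [beq_iff_eq, show [0, 1, 2, 3, 4, 5] = code 1 from by decide]
  exact code_injective.eq_iff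

theorem fl_code (g : Perm (Fin 6)) : fl (code g) = stF g := by
  have h4 : sq (sq (code g)) = code (g ^ 4) := by
    unfold sq
    rw [← code_mul, ← code_mul]
    rfl
  have h5 : cmp (sq (sq (code g))) (code g) = code (g ^ 5) := by
    rw [h4, ← code_mul]
    rfl
  unfold fl stF
  rw [h5, h4]
  simp only [Bool.cond_eq_ite, isid_code]

theorem sgl_code (g : Perm (Fin 6)) : sgl (code g) = (Perm.sign g : ℤ) := by
  rw [Equiv.Perm.sign_eq_prod_prod_Iio]
  unfold sgl
  simp only [ap_code, Fin.val_fin_lt]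
  push_cast
  rw [← List.ofFn_eq_map, List.prod_ofFn]
  refine Finset.prod_congr rfl fun j _ => ?_
  rw [← List.ofFn_eq_map, List.prod_ofFn, ← Finset.prod_filter]
  refine Finset.prod_congr ?_ fun i _ => ?_
  · ext i; simp
  · split_ifs <;> simp

def LL : List (List ℕ) := (List.permutations' [0, 1, 2, 3, 4, 5]).filter fun l => sgl l == 1

set_option maxRecDepth 100000 in
theorem LL_length : LL.length = 360 := by decide +kernel

theorem LL_nodup : LL.Nodup := by
  unfold LL
  apply List.Nodup.filter
  rw [(List.permutations_perm_permutations' _).symm.nodup_iff]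
  apply List.nodup_permutations
  decide

abbrev A6 := ↥(alternatingGroup (Fin 6))

theorem cardA6 : Nat.card A6 = 360 := by
  rw [nat_card_alternatingGroup]; simp [Nat.factorial]

theorem code_mem (g : A6) : code g ∈ LL := by
  unfold LL
  rw [List.mem_filter, List.mem_permutations']
  constructor
  · rw [show [0, 1, 2, 3, 4, 5] = List.ofFn (fun i : Fin 6 => (i : ℕ)) from by decide]
    exact Equiv.Perm.ofFn_comp_perm (g : Perm (Fin 6)) (fun i : Fin 6 => (i : ℕ))
  · rw [sgl_code, Equiv.Perm.mem_alternatingGroup.1 g.2]; rfl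

theorem sum_code (F : List ℕ → ℕ) : ∑ g : A6, F (code g) = (LL.map F).sum := by
  have hinj : Function.Injective (fun g : A6 => code g) :=
    code_injective.comp Subtype.val_injective
  have h : Finset.univ.image (fun g : A6 => code g) = LL.toFinset := by
    apply Finset.eq_of_subset_of_card_le
    · intro l hl
      obtain ⟨g, -, rfl⟩ := Finset.mem_image.1 hl
      exact List.mem_toFinset.2 (code_mem g)
    · rw [Finset.card_image_of_injective _ hinj, List.toFinset_card_of_nodup LL_nodup, LL_length,
        Finset.card_univ, ← Nat.card_eq_fintype_card, cardA6]
  rw [← List.sum_toFinset _ LL_nodup, ← h, Finset.sum_image fun _ _ _ _ e => hinj e]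

def chk (r : List ℕ) : Bool :=
  (LL.map fun l => fl l * fl (cmp l r)).sum % 3 == fl r % 3

def reps : List (Perm (Fin 6)) :=
  [1, swap 0 1 * swap 1 2, swap 0 1 * swap 1 2 * (swap 3 4 * swap 4 5),
    swap 0 1 * swap 2 3, swap 0 1 * swap 1 2 * swap 2 3 * swap 4 5,
    swap 0 1 * swap 1 2 * swap 2 3 * swap 3 4]

set_option maxRecDepth 100000 in
theorem chk_reps : (reps.all fun r => chk (code r)) = true := by decide +kernel

set_option maxRecDepth 100000 in
theorem LL_sum : 3 ∣ (LL.map fl).sum := by decide +kernel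

theorem conj_rep (r : A6) : ∃ s ∈ reps, IsConj s (r : Perm (Fin 6)) := by
  have key : (r : Perm (Fin 6)).cycleType ∈
      ([0, {3}, {3, 3}, {2, 2}, {4, 2}, {5}] : List (Multiset ℕ)) := by
    have h2 : ∀ n ∈ (r : Perm (Fin 6)).cycleType, 2 ≤ n := fun n hn =>
      Equiv.Perm.two_le_of_mem_cycleType hn
    have hs : (r : Perm (Fin 6)).cycleType.sum ≤ 6 := by
      rw [Equiv.Perm.sum_cycleType]
      exact (Finset.card_le_univ _).trans (by simp)
    have he : Even ((r : Perm (Fin 6)).cycleType.sum + (r : Perm (Fin 6)).cycleType.card) := by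
      have := Equiv.Perm.mem_alternatingGroup.1 r.2
      rw [Equiv.Perm.sign_of_cycleType] at this
      by_contra hne
      rw [Nat.not_even_iff_odd] at hne
      rw [hne.neg_one_pow] at this
      exact absurd this (by decide)
    have hc := Multiset.card_nsmul_le_sum h2
    generalize (r : Perm (Fin 6)).cycleType = m at *
    have hc3 : m.card ≤ 3 := by simp only [smul_eq_mul] at hc; omega
    interval_cases hm : m.card
    · rw [Multiset.card_eq_zero] at hm
      subst hm; decide
    · obtain ⟨a, rfl⟩ := Multiset.card_eq_one.1 hm
      simp at hs he h2
      interval_cases a <;> first | decide | (exfalso; revert he; decide)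
    · obtain ⟨a, b, rfl⟩ := Multiset.card_eq_two.1 hm
      simp at hs he h2
      obtain ⟨ha, hb⟩ := h2
      have : a ≤ 4 := by omega
      have : b ≤ 4 := by omega
      interval_cases a <;> interval_cases b <;>
        first | decide | omega | (exfalso; revert he; decide)
    · exfalso
      simp only [smul_eq_mul] at hc
      have : m.sum = 6 := by omega
      rw [this] at he
      revert he; decide
  have hh : ([0, {3}, {3, 3}, {2, 2}, {4, 2}, {5}] : List (Multiset ℕ)) =
      reps.map fun s => s.cycleType := by decide +kernel
  rw [hh, List.mem_map] at key
  obtain ⟨s, hs, e⟩ := key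
  exact ⟨s, hs, Equiv.Perm.isConj_iff_cycleType_eq.2 e⟩

theorem reps_pow : ∀ s ∈ reps, s ^ 3 = 1 ∨ s ^ 4 = 1 ∨ s ^ 5 = 1 := by decide +kernel

theorem A6_pow (r : A6) : r ^ 3 = 1 ∨ r ^ 4 = 1 ∨ r ^ 5 = 1 := by
  obtain ⟨s, hs, hc⟩ := conj_rep r
  obtain ⟨c, hc⟩ := isConj_iff.1 hc
  have := reps_pow s hs
  simp only [← Subtype.coe_inj, Subgroup.coe_pow, Subgroup.coe_one, ← hc, conj_pow,
    conj_eq_one_iff]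
  exact this

theorem chk_code (s : Perm (Fin 6)) (h : chk (code s) = true) :
    ∑ g : A6, stF (g : Perm (Fin 6)) * stF ((g : Perm (Fin 6)) * s) ≡ stF s [MOD 3] := by
  have h : (LL.map fun l => fl l * fl (cmp l (code s))).sum ≡ fl (code s) [MOD 3] := beq_iff_eq.1 h
  rw [← sum_code] at h
  simpa only [← code_mul, fl_code] using h

theorem conv (r : A6) :
    ∑ g : A6, stF (g : Perm (Fin 6)) * stF ((g : Perm (Fin 6)) * r) ≡
      stF (r : Perm (Fin 6)) [MOD 3] := by
  obtain ⟨s, hs, hc⟩ := conj_rep r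
  obtain ⟨c, hc⟩ := isConj_iff.1 hc
  have h1 := chk_code s (List.all_eq_true.1 chk_reps s hs)
  rw [← hc, stF_conj]
  have hsum : ∑ g : A6, stF (g : Perm (Fin 6)) * stF ((g : Perm (Fin 6)) * s) =
      ∑ g : A6, stF (g : Perm (Fin 6)) * stF ((g : Perm (Fin 6)) * (c * s * c⁻¹)) := by
    refine Fintype.sum_equiv (MulAut.conjNormal c : MulAut A6).toEquiv _ _ fun g => ?_
    have e : (((MulAut.conjNormal c : MulAut A6).toEquiv g : A6) : Perm (Fin 6)) =
      c * g * c⁻¹ := rfl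
    have e2 : c * (g : Perm (Fin 6)) * c⁻¹ * (c * s * c⁻¹) = c * (g * s) * c⁻¹ := by group
    rw [e, e2, stF_conj, stF_conj]
  rw [← hsum]
  exact h1

theorem sum_all : 3 ∣ ∑ g : A6, stF (g : Perm (Fin 6)) := by
  have h := LL_sum
  rw [← sum_code] at h
  simpa only [fl_code] using h

/-! ### Nonvanishing of the Steinberg character sum on a suitable overgroup -/

/-- `stF` on the subtype. -/
def sf (g : A6) : ℕ := stF (g : Perm (Fin 6))

theorem sf_def (g : A6) :
    sf g = if g = 1 then 0 else if g ^ 4 = 1 then 1 else if g ^ 5 = 1 then 2 else 0 := by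
  simp only [sf, stF, ← Subtype.coe_inj, Subgroup.coe_pow, Subgroup.coe_one]

theorem sum_sf : 3 ∣ ∑ g : A6, sf g := by
  have h := sum_all
  simpa only [sf] using h

theorem sf_conj (c g : A6) : sf (c * g * c⁻¹) = sf g := stF_conj _ _

theorem sf_inv (g : A6) : sf g⁻¹ = sf g := stF_inv _

open Classical in
theorem sum_two (P : Subgroup A6) (hP : Nat.card P = 8) :
    ∑ g : P, sf (g : A6) = 7 := by
  have h : ∀ g : P, sf (g : A6) = if g = 1 then 0 else 1 := by
    intro g
    rw [sf_def]
    have h8 : (g : A6) ^ 8 = 1 := by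
      rw [← hP]; exact_mod_cast congrArg Subtype.val (pow_card_eq_one' (x := g))
    have h4 : (g : A6) ^ 4 = 1 := by
      rcases A6_pow (g : A6) with h | h | h
      · have : (g : A6) = 1 := by
          have := pow_gcd_eq_one.2 ⟨h8, h⟩
          simpa using this
        simp [this]
      · exact h
      · have : (g : A6) = 1 := by
          have := pow_gcd_eq_one.2 ⟨h8, h⟩
          simpa using this
        simp [this]
    rw [if_pos h4]
    simp
  simp only [h]
  rw [Finset.sum_ite, Finset.sum_const_zero, zero_add, Finset.sum_const, smul_eq_mul, mul_one,
    Finset.filter_ne', Finset.card_erase_of_mem (Finset.mem_univ _), Finset.card_univ,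
    ← Nat.card_eq_fintype_card, hP]

open Classical in
theorem sum_five (P : Subgroup A6) (h3 : ¬ 3 ∣ Nat.card P) (h5 : 5 ∣ Nat.card P) :
    (∑ g : P, sf (g : A6)) % 3 ≠ 0 := by
  have : Fact (Nat.Prime 5) := ⟨by norm_num⟩
  have hd : Nat.card P ∣ 40 := by
    have h : Nat.card P ∣ 3 ^ 2 * 40 := by
      have := Subgroup.card_subgroup_dvd_card P
      rwa [cardA6] at this
    refine Nat.Coprime.dvd_of_dvd_mul_left ?_ h
    exact ((Nat.Prime.coprime_iff_not_dvd (by norm_num)).2 h3).symm.pow_right 2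
  obtain ⟨m, hm⟩ := h5
  have hm8 : m ∣ 8 := by
    rw [hm] at hd
    exact Nat.dvd_of_mul_dvd_mul_left (k := 5) (by norm_num) hd
  have hm0 : m ≤ 8 := Nat.le_of_dvd (by norm_num) hm8
  have hcases : m = 1 ∨ m = 2 ∨ m = 4 ∨ m = 8 := by
    interval_cases m <;> revert hm8 <;> decide
  -- the Sylow 5-subgroup
  let Q : Sylow 5 P := default
  have hQ : Nat.card Q = 5 := by
    have hf : (Nat.card P).factorization 5 = 1 := by
      rw [hm]
      rcases hcases with rfl | rfl | rfl | rfl <;>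
        · rw [Nat.factorization_mul (by norm_num) (by norm_num), Finsupp.add_apply,
            Nat.Prime.factorization_self (by norm_num), Nat.factorization_eq_zero_of_not_dvd]
          norm_num
    have := Q.card_eq_multiplicity
    rw [hf] at this
    simpa using this
  have hidx : (Q : Subgroup P).index = m := by
    have := (Q : Subgroup P).card_mul_index
    have hQ' : Nat.card (Q : Subgroup P) = 5 := hQ
    rw [hQ', hm] at this
    omega
  have hone : Nat.card (Sylow 5 P) = 1 := by
    have h1 := card_sylow_modEq_one 5 P
    have h2 := (Q.card_dvd_index).trans (hidx ▸ hm8)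
    have h3 : Nat.card (Sylow 5 P) ≤ 8 := Nat.le_of_dvd (by norm_num) h2
    generalize Nat.card (Sylow 5 P) = c at *
    interval_cases c <;> first | rfl | (exfalso; revert h1; decide) | (exfalso; revert h2; decide)
  have hsub : Subsingleton (Sylow 5 P) := (Nat.card_eq_one_iff_unique.1 hone).1
  have hmem : ∀ g : P, g ^ 5 = 1 ↔ g ∈ (Q : Subgroup P) := by
    intro g
    constructor
    · intro hg
      have hp : IsPGroup 5 (Subgroup.zpowers g) := by
        rintro ⟨x, hx⟩
        obtain ⟨n, rfl⟩ := Subgroup.mem_zpowers_iff.1 hx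
        refine ⟨1, ?_⟩
        apply Subtype.ext
        simp only [pow_one, Subgroup.coe_pow, Subgroup.coe_one]
        rw [← zpow_natCast, ← zpow_mul, mul_comm, zpow_mul, zpow_natCast, hg, one_zpow]
      obtain ⟨R, hR⟩ := hp.exists_le_sylow
      rw [Subsingleton.elim R Q] at hR
      exact hR (Subgroup.mem_zpowers g)
    · intro hg
      have := pow_card_eq_one' (x := (⟨g, hg⟩ : (Q : Subgroup P)))
      have hQ' : Nat.card (Q : Subgroup P) = 5 := hQ
      rw [hQ'] at this
      exact congrArg Subtype.val this
  have hval : ∀ g : P, sf (g : A6) + (if g = 1 then 2 else 0) =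
      1 + (if g ∈ (Q : Subgroup P) then 1 else 0) := by
    intro g
    rw [sf_def, ← hmem]
    by_cases h1 : g = 1
    · simp [h1]
    have h1' : (g : A6) ≠ 1 := fun h => h1 (Subtype.ext h)
    have e5 : g ^ 5 = 1 ↔ (g : A6) ^ 5 = 1 := by
      rw [← Subtype.coe_inj, Subgroup.coe_pow, Subgroup.coe_one]
    rw [e5, if_neg h1', if_neg h1, add_zero]
    have h40 : (g : A6) ^ 40 = 1 := by
      obtain ⟨c, hc⟩ := hd
      have := congrArg Subtype.val (pow_card_eq_one' (x := g))
      rw [Subgroup.coe_pow, Subgroup.coe_one] at this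
      rw [hc, pow_mul, this, one_pow]
    rcases A6_pow (g : A6) with h | h | h
    · exact absurd (by simpa using pow_gcd_eq_one.2 ⟨h40, h⟩) h1'
    · have : (g : A6) ^ 5 ≠ 1 := fun h' => h1' (by simpa using pow_gcd_eq_one.2 ⟨h, h'⟩)
      rw [if_pos h, if_neg this]
    · have : (g : A6) ^ 4 ≠ 1 := fun h' => h1' (by simpa using pow_gcd_eq_one.2 ⟨h, h'⟩)
      rw [if_neg this, if_pos h, if_pos h]
  have hsum := Finset.sum_congr (rfl : (Finset.univ : Finset P) = Finset.univ) fun g _ => hval g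
  have hQ2 : ∑ g : P, (if g ∈ (Q : Subgroup P) then 1 else 0) = 5 := by
    have hQ' := hQ
    rw [Nat.card_eq_fintype_card, Fintype.card_subtype] at hQ'
    rw [Finset.sum_boole]
    exact_mod_cast hQ'
  rw [Finset.sum_add_distrib, Finset.sum_add_distrib, hQ2, Finset.sum_ite_eq' Finset.univ (1 : P),
    if_pos (Finset.mem_univ _), Finset.sum_const, Finset.card_univ, ← Nat.card_eq_fintype_card,
    smul_eq_mul, mul_one] at hsum
  omega

open Classical in
theorem exists_over (H : Subgroup A6) (h3 : ¬ 3 ∣ Nat.card H) :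
    ∃ P : Subgroup A6, H ≤ P ∧ (∑ g : P, sf (g : A6)) % 3 ≠ 0 := by
  by_cases h5 : 5 ∣ Nat.card H
  · exact ⟨H, le_rfl, sum_five H h3 h5⟩
  have : Fact (Nat.Prime 2) := ⟨by norm_num⟩
  have hd : Nat.card H ∣ 2 ^ 3 := by
    have h : Nat.card H ∣ 3 ^ 2 * (5 * 2 ^ 3) := by
      have := Subgroup.card_subgroup_dvd_card H
      rwa [cardA6] at this
    have h' := Nat.Coprime.dvd_of_dvd_mul_left
      (((Nat.Prime.coprime_iff_not_dvd (by norm_num)).2 h3).symm.pow_right 2) h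
    exact Nat.Coprime.dvd_of_dvd_mul_left
      ((Nat.Prime.coprime_iff_not_dvd (by norm_num)).2 h5).symm h'
  obtain ⟨j, -, hj⟩ := (Nat.dvd_prime_pow (by norm_num)).1 hd
  obtain ⟨P, hP⟩ := (IsPGroup.of_card hj).exists_le_sylow
  refine ⟨P, hP, ?_⟩
  have hc : Nat.card (P : Subgroup A6) = 8 := by
    rw [P.card_eq_multiplicity, cardA6]
    have : (360 : ℕ).factorization 2 = 3 := by
      rw [show 360 = 2 ^ 3 * 45 from rfl, Nat.factorization_mul (by norm_num) (by norm_num),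
        Finsupp.add_apply, Nat.Prime.factorization_pow (by norm_num),
        Nat.factorization_eq_zero_of_not_dvd (n := 45) (by norm_num)]
      simp
    rw [this]; rfl
  have := sum_two _ hc
  rw [this]; decide

/-! ### The Steinberg idempotent -/

section Idem
variable (k : Type) [Field k]

noncomputable def idem : MonoidAlgebra k A6 :=
  ∑ g : A6, MonoidAlgebra.single g (sf g : k)

theorem idem_comm (x : MonoidAlgebra k A6) : idem k * x = x * idem k := by
  induction x using MonoidAlgebra.induction_linear with
  | zero => simp
  | add f g hf hg => rw [mul_add, add_mul, hf, hg]
  | single a t =>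
    unfold idem
    rw [Finset.sum_mul, Finset.mul_sum]
    refine Fintype.sum_equiv (MulAut.conj a⁻¹).toEquiv _ _ fun g => ?_
    have e : (MulAut.conj a⁻¹).toEquiv g = a⁻¹ * g * a⁻¹⁻¹ := rfl
    rw [MonoidAlgebra.single_mul_single, MonoidAlgebra.single_mul_single, e, sf_conj,
      mul_comm t]
    congr 1
    group

theorem conv' [CharP k 3] (r : A6) : ∑ g : A6, ((sf g : k) * (sf (g⁻¹ * r) : k)) = sf r := by
  have h : ∑ g : A6, ((sf g : k) * (sf (g⁻¹ * r) : k)) =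
      ((∑ g : A6, stF (g : Perm (Fin 6)) * stF ((g : Perm (Fin 6)) * r) : ℕ) : k) := by
    push_cast
    refine Fintype.sum_equiv (Equiv.inv A6) _ _ fun g => ?_
    rw [← sf_inv g]
    rfl
  rw [h]
  exact CharP.natCast_eq_natCast' k 3 (conv r)

theorem idem_idem [CharP k 3] : idem k * idem k = idem k := by
  have h : ∀ g : A6, MonoidAlgebra.single g (sf g : k) * idem k =
      ∑ r : A6, MonoidAlgebra.single r ((sf g : k) * (sf (g⁻¹ * r) : k)) := by
    intro g
    unfold idem
    rw [Finset.mul_sum]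
    refine Fintype.sum_equiv (Equiv.mulLeft g) _ _ fun r => ?_
    rw [MonoidAlgebra.single_mul_single]
    simp
  conv_lhs => enter [1]; unfold idem
  rw [Finset.sum_mul]
  simp only [h]
  rw [Finset.sum_comm]
  unfold idem
  refine Finset.sum_congr rfl fun r _ => ?_
  rw [← conv' k r]
  exact (map_sum (MonoidAlgebra.singleAddHom r) _ _).symm

variable (H : Subgroup A6)

/-- The base vector of the permutation module. -/
noncomputable def vec : PermMod k H :=
  (Representation.ofMulAction k A6 (A6 ⧸ H)).asModuleEquiv.symm
    (MonoidAlgebra.single ((1 : A6) : A6 ⧸ H) 1)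

open Classical in
/-- Sum of the coefficients at the cosets contained in `P`. -/
noncomputable def phi (P : Subgroup A6) : PermMod k H →ₗ[k] k :=
  (Finsupp.linearCombination k fun x : A6 ⧸ H => if x.out ∈ P then (1 : k) else 0) ∘ₗ
    (MonoidAlgebra.coeffLinearEquiv k).toLinearMap ∘ₗ
    (Representation.ofMulAction k A6 (A6 ⧸ H)).asModuleEquiv.toLinearMap

theorem out_mem (P : Subgroup A6) (hP : H ≤ P) (g : A6) : ((g : A6 ⧸ H)).out ∈ P ↔ g ∈ P := by
  obtain ⟨h, hh⟩ := QuotientGroup.mk_out_eq_mul H g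
  rw [hh]
  exact P.mul_mem_cancel_right (hP h.2)

theorem phi_vec (P : Subgroup A6) (hP : H ≤ P) : phi k H P (vec k H) = 1 := by
  have := (out_mem H P hP 1).2 P.one_mem
  simp [phi, vec, this]

open Classical in
theorem phi_idem (P : Subgroup A6) (hP : H ≤ P) :
    phi k H P (idem k • vec k H) = ((∑ g : P, sf (g : A6) : ℕ) : k) := by
  have h1 : ∀ g : A6, phi k H P (MonoidAlgebra.single g (sf g : k) • vec k H) =
      if g ∈ P then (sf g : k) else 0 := by
    intro g
    have hh := out_mem H P hP g
    have e : MonoidAlgebra.single g (sf g : k) • vec k H =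
        (Representation.ofMulAction k A6 (A6 ⧸ H)).asModuleEquiv.symm
          (MonoidAlgebra.single (g : A6 ⧸ H) (sf g : k)) := by
      apply (Representation.ofMulAction k A6 (A6 ⧸ H)).asModuleEquiv.injective
      rw [Representation.asModuleEquiv_map_smul, Representation.asAlgebraHom_single]
      simp [vec]
    rw [e]
    simp [phi, hh]
  unfold idem
  rw [Finset.sum_smul, map_sum]
  simp only [h1]
  rw [Finset.sum_ite, Finset.sum_const_zero, add_zero]
  push_cast
  rw [Finset.sum_subtype _ (p := fun g => g ∈ P) (by simp)]

/-- Multiplication by the central idempotent. -/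
noncomputable def proj : PermMod k H →ₗ[MonoidAlgebra k A6] PermMod k H where
  toFun v := idem k • v
  map_add' := smul_add _
  map_smul' x v := by
    rw [RingHom.id_apply, smul_smul, smul_smul, idem_comm]

theorem proj_idem [CharP k 3] : IsIdempotentElem (proj k H) := by
  ext v : 1
  change idem k • idem k • v = idem k • v
  rw [smul_smul, idem_idem]

end Idem
end A6St

/-- The alternating group `A_6` does not have property `(I_3)` with respect to any of its
subgroups: for no subgroup `H ≤ A_6` of order coprime to `3` is the permutation module
`k[A_6/H]` indecomposable, `k` an algebraically closed field of characteristic `3`. -/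
theorem stmt19 (k : Type) [Field k] [IsAlgClosed k] [CharP k 3] :
    ∀ H : Subgroup ↥(alternatingGroup (Fin 6)), ¬ HasIp k 3 H := by
  classical
  rintro H ⟨h3, -, hind⟩
  obtain ⟨P, hHP, hP⟩ := A6St.exists_over H h3
  rcases hind _ _ (LinearMap.IsIdempotentElem.isCompl (A6St.proj_idem k H)) with h | h
  · have h0 : A6St.idem k • A6St.vec k H = 0 := by
      have : A6St.proj k H (A6St.vec k H) ∈ LinearMap.range (A6St.proj k H) := ⟨_, rfl⟩
      rw [h] at this
      exact this
    have h1 := A6St.phi_idem k H P hHP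
    rw [h0, map_zero, eq_comm, CharP.cast_eq_zero_iff k 3] at h1
    exact hP (Nat.mod_eq_zero_of_dvd h1)
  · have h0 : A6St.idem k • A6St.vec k H = A6St.vec k H := by
      have : A6St.idem k • A6St.vec k H - A6St.vec k H ∈ LinearMap.ker (A6St.proj k H) := by
        rw [LinearMap.mem_ker, map_sub, sub_eq_zero]
        exact LinearMap.congr_fun (A6St.proj_idem k H) (A6St.vec k H)
      rw [h] at this
      exact sub_eq_zero.1 this
    have h1 := A6St.phi_idem k H ⊤ le_top
    rw [h0, A6St.phi_vec k H ⊤ le_top] at h1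
    have h2 : ∑ g : (⊤ : Subgroup A6St.A6), A6St.sf (g : A6St.A6) = ∑ g : A6St.A6, A6St.sf g :=
      Fintype.sum_equiv Subgroup.topEquiv.toEquiv _ _ fun g => rfl
    have h3 : 3 ∣ ∑ g : A6St.A6, A6St.sf g := A6St.sum_sf
    rw [h2, (CharP.cast_eq_zero_iff k 3 _).2 h3] at h1
    exact one_ne_zero h1
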